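/- Let k be a field of characteristic zero and let A be a smooth k-algebra (formally smooth and of finite presentation). View A as a module over the ring A ⊗_k A via the multiplication map A ⊗_k A → A. Then for every n ≥ 0 there is an isomorphism of A-modules Tor_n^{A ⊗_k A}(A, A) ≅ ⋀ⁿ_A Ω_{A/k}, the n-th exterior power over A of the module of Kähler differentials of A over k. -/

import Mathlib

open CategoryTheory TensorProduct

universe u

namespace KoszulKaehler

section DeRham

variable (R : Type*) {S : Type*} [CommRing R] [CommRing S] [Algebra R S]

open ExteriorAlgebra KaehlerDifferential

/-- The ring homomorphism sending `a` to the matrix with diagonal `a` and upper right entry `da`. -/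
noncomputable def scalarMatrix :
    S →+* Matrix (Fin 2) (Fin 2) (ExteriorAlgebra S (Ω[S⁄R])) where
  toFun a := !![algebraMap S _ a, ι S (D R S a); 0, algebraMap S _ a]
  map_one' := by simp [Matrix.one_fin_two]
  map_zero' := by
    ext i j
    fin_cases i <;> fin_cases j <;> simp
  map_add' a b := by simp
  map_mul' a b := by
    simp only [Matrix.mul_fin_two, map_mul, Derivation.leibniz, map_add, map_smul, Algebra.smul_def]
    simp [Algebra.commutes b]

lemma scalarMatrix_apply (a : S) :
    scalarMatrix R a = !![algebraMap S _ a, ι S (D R S a); 0, algebraMap S _ a] := rfl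

/-- The diagonal matrix with entries `-dx` and `dx`. -/
noncomputable def formMatrix (x : S) :
    Matrix (Fin 2) (Fin 2) (ExteriorAlgebra S (Ω[S⁄R])) :=
  !![-ι S (D R S x), 0; 0, ι S (D R S x)]

variable {R} in
lemma ι_mul_ι_add (x y : Ω[S⁄R]) : ι S x * ι S y + ι S y * ι S x = 0 :=
  ι_add_mul_swap x y

lemma scalarMatrix_mul_formMatrix (a x : S) :
    scalarMatrix R a * formMatrix R x = formMatrix R x * scalarMatrix R a := by
  have h := ι_mul_ι_add (D R S a) (D R S x)
  simp only [scalarMatrix_apply, formMatrix, Matrix.mul_fin_two, Algebra.commutes a]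
  ext i j
  fin_cases i <;> fin_cases j <;> simp
  exact eq_neg_of_add_eq_zero_left h

lemma formMatrix_mul_add (x y : S) :
    formMatrix R x * formMatrix R y + formMatrix R y * formMatrix R x = 0 := by
  have h := ι_mul_ι_add (D R S x) (D R S y)
  ext i j
  fin_cases i <;> fin_cases j <;> simp [formMatrix, h]

lemma formMatrix_mul_self (x : S) :
    formMatrix R x * formMatrix R x = 0 := by
  have h : ι S (D R S x) * ι S (D R S x) = 0 := ι_sq_zero _
  rw [formMatrix, Matrix.mul_fin_two]
  ext i j
  fin_cases i <;> fin_cases j <;> simp [h]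

lemma formMatrix_mul (x y : S) :
    formMatrix R (x * y) = scalarMatrix R x * formMatrix R y + scalarMatrix R y * formMatrix R x := by
  have h : ι S (D R S x) * ι S (D R S y) + ι S (D R S y) * ι S (D R S x) = 0 := ι_mul_ι_add _ _
  have e : ι S (D R S (x * y)) = algebraMap S (ExteriorAlgebra S (Ω[S⁄R])) x * ι S (D R S y) +
      algebraMap S (ExteriorAlgebra S (Ω[S⁄R])) y * ι S (D R S x) := by
    rw [Derivation.leibniz, map_add, map_smul, map_smul, Algebra.smul_def, Algebra.smul_def]
  rw [formMatrix, formMatrix, formMatrix, scalarMatrix_apply, scalarMatrix_apply, e]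
  generalize ι S (D R S x) = u at h
  generalize ι S (D R S y) = v at h
  generalize algebraMap S (ExteriorAlgebra S (Ω[S⁄R])) x = a
  generalize algebraMap S (ExteriorAlgebra S (Ω[S⁄R])) y = b
  rw [Matrix.mul_fin_two, Matrix.mul_fin_two]
  simp [h, add_comm]

lemma formMatrix_add (x y : S) : formMatrix R (x + y) = formMatrix R x + formMatrix R y := by
  rw [formMatrix, formMatrix, formMatrix, map_add, map_add]
  simp [add_comm]

lemma formMatrix_algebraMap (r : R) : formMatrix R (algebraMap R S r) = 0 := by
  rw [formMatrix, Derivation.map_algebraMap, map_zero]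
  ext i j
  fin_cases i <;> fin_cases j <;> simp

/-- The two kinds of matrices above extend to a representation of the exterior algebra. -/
theorem exists_matrix_ringHom :
    ∃ Φ : ExteriorAlgebra S (Ω[S⁄R]) →+* Matrix (Fin 2) (Fin 2) (ExteriorAlgebra S (Ω[S⁄R])),
      (∀ a, Φ (algebraMap S _ a) = scalarMatrix R a) ∧
      ∀ x, Φ (ι S (D R S x)) = formMatrix R x := by
  let C := Subring.centralizer (Set.range (scalarMatrix R (S := S)))
  have hf (a : S) : scalarMatrix R a ∈ C := by
    rw [Subring.mem_centralizer_iff]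
    rintro _ ⟨b, rfl⟩
    rw [← map_mul, ← map_mul, mul_comm]
  have hg (x : S) : formMatrix R x ∈ C := by
    rw [Subring.mem_centralizer_iff]
    rintro _ ⟨b, rfl⟩
    exact scalarMatrix_mul_formMatrix R b x
  let f : S →+* C := (scalarMatrix R (S := S)).codRestrict C hf
  have hcomm (a : S) (c : C) : f a * c = c * f a :=
    Subtype.ext (Subring.mem_centralizer_iff.1 c.2 _ ⟨a, rfl⟩)
  let _ : Algebra S C := f.toAlgebra' hcomm
  let _ : Algebra R C := (f.comp (algebraMap R S)).toAlgebra' fun r c ↦ hcomm _ c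
  have : IsScalarTower R S C := IsScalarTower.of_algebraMap_eq' rfl
  have smul_val (a : S) (c : C) : (a • c).1 = scalarMatrix R a * c.1 := by
    rw [Algebra.smul_def]; rfl
  have leib (x y : S) : (⟨formMatrix R (x * y), hg _⟩ : C) =
      x • ⟨formMatrix R y, hg y⟩ + y • ⟨formMatrix R x, hg x⟩ := by
    refine Subtype.ext ?_
    change _ = (x • _ : C).1 + (y • _ : C).1
    rw [smul_val, smul_val]
    exact formMatrix_mul R x y
  let D' : Derivation R S C := Derivation.mk'
    { toFun := fun x ↦ ⟨formMatrix R x, hg x⟩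
      map_add' := fun x y ↦ Subtype.ext (formMatrix_add R x y)
      map_smul' := fun r x ↦ by
        have h0 : (⟨formMatrix R (algebraMap R S r), hg _⟩ : C) = 0 :=
          Subtype.ext (formMatrix_algebraMap R r)
        rw [RingHom.id_apply, ← algebraMap_smul S r (_ : C), Algebra.smul_def, leib, h0, smul_zero,
          add_zero] }
    leib
  let δ := D'.liftKaehlerDifferential
  have hδ (x : S) : (δ (D R S x)).1 = formMatrix R x := by
    simp only [δ, Derivation.liftKaehlerDifferential_comp_D]; rfl
  have span (m : Ω[S⁄R]) : m ∈ Submodule.span S (Set.range (D R S)) := by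
    rw [span_range_derivation]; trivial
  have anti (m m' : Ω[S⁄R]) : δ m * δ m' + δ m' * δ m = 0 := by
    induction span m using Submodule.span_induction with
    | zero => simp
    | add x y _ _ hx hy =>
      rw [map_add, add_mul, mul_add, add_add_add_comm, hx, hy, add_zero]
    | smul a x _ hx => rw [map_smul, smul_mul_assoc, mul_smul_comm, ← smul_add, hx, smul_zero]
    | mem x hx =>
      obtain ⟨x, rfl⟩ := hx
      induction span m' using Submodule.span_induction with
      | zero => simp
      | add x y _ _ hx hy =>
        rw [map_add, add_mul, mul_add, add_add_add_comm, hx, hy, add_zero]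
      | smul a x _ hx => rw [map_smul, smul_mul_assoc, mul_smul_comm, ← smul_add, hx, smul_zero]
      | mem y hy =>
        obtain ⟨y, rfl⟩ := hy
        refine Subtype.ext ?_
        change (δ (D R S x)).1 * (δ (D R S y)).1 + (δ (D R S y)).1 * (δ (D R S x)).1 = 0
        rw [hδ, hδ, formMatrix_mul_add]
  have sq (m : Ω[S⁄R]) : δ m * δ m = 0 := by
    induction span m using Submodule.span_induction with
    | zero => simp
    | add x y _ _ hx hy =>
      rw [map_add, add_mul, mul_add, mul_add, hx, hy, add_zero, zero_add, anti]
    | smul a x _ hx => rw [map_smul, smul_mul_assoc, mul_smul_comm, hx, smul_zero, smul_zero]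
    | mem x hx =>
      obtain ⟨x, rfl⟩ := hx
      refine Subtype.ext ?_
      change (δ (D R S x)).1 * (δ (D R S x)).1 = 0
      rw [hδ, formMatrix_mul_self]
  let Φ : ExteriorAlgebra S (Ω[S⁄R]) →ₐ[S] C := lift S ⟨δ, sq⟩
  have hΦι (m : Ω[S⁄R]) : Φ (ι S m) = δ m := lift_ι_apply ..
  refine ⟨C.subtype.comp Φ.toRingHom, fun a ↦ ?_, fun x ↦ ?_⟩
  · change (Φ (algebraMap S _ a)).1 = _
    rw [AlgHom.commutes]
    rfl
  · change (Φ _).1 = _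
    rw [hΦι, hδ]

/-- The exterior derivative on the algebra of differential forms. -/
theorem exists_exteriorDerivative (R S : Type*) [CommRing R] [CommRing S] [Algebra R S] :
    ∃ d : ExteriorAlgebra S (Ω[S⁄R]) →+ ExteriorAlgebra S (Ω[S⁄R]),
      d 1 = 0 ∧ (∀ (a : S) ω, d (a • ω) = ι S (D R S a) * ω + a • d ω) ∧
      ∀ (x : S) ω, d (ι S (D R S x) * ω) = - (ι S (D R S x) * d ω) := by
  obtain ⟨Φ, h₁, h₂⟩ := exists_matrix_ringHom R (S := S)
  have span (m : Ω[S⁄R]) : m ∈ Submodule.span S (Set.range (D R S)) := by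
    rw [span_range_derivation]; trivial
  have low (m : Ω[S⁄R]) : Φ (ι S m) 1 0 = 0 ∧ Φ (ι S m) 1 1 = ι S m := by
    induction span m using Submodule.span_induction with
    | zero => simp
    | add x y _ _ hx hy => simp [hx, hy]
    | smul a x _ hx =>
      rw [map_smul, Algebra.smul_def, map_mul, h₁]
      simp [scalarMatrix_apply, Matrix.mul_apply, hx]
    | mem x hx =>
      obtain ⟨x, rfl⟩ := hx
      rw [h₂]; simp [formMatrix]
  have hlow (ω) : Φ ω 1 1 = ω := by
    induction ω using CliffordAlgebra.left_induction with
    | algebraMap r =>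
      change Φ (algebraMap S (ExteriorAlgebra S (Ω[S⁄R])) r) 1 1 = _
      rw [h₁]
      simp [scalarMatrix_apply]
    | add x y hx hy => rw [map_add, Matrix.add_apply, hx, hy]
    | ι_mul x m hx =>
      change Φ (ι S m * x) 1 1 = ι S m * x
      rw [map_mul, Matrix.mul_apply]
      simp [low, hx]
  refine ⟨{ toFun := fun ω ↦ Φ ω 0 1, map_zero' := by simp, map_add' := by simp },
    ?_, fun a ω ↦ ?_, fun x ω ↦ ?_⟩
  · simp
  · change Φ (a • ω) 0 1 = _ + a • Φ ω 0 1
    rw [Algebra.smul_def, Algebra.smul_def, map_mul, h₁, Matrix.mul_apply]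
    simp [scalarMatrix_apply, hlow, add_comm]
  · change Φ (ι S (D R S x) * ω) 0 1 = - (_ * Φ ω 0 1)
    rw [map_mul, h₂, Matrix.mul_apply]
    simp [formMatrix]

end DeRham

section Contraction

open ExteriorAlgebra KaehlerDifferential Pointwise

section

variable {S M : Type*} [CommRing S] [AddCommGroup M] [Module S M]

/-- Contraction of exterior forms with a linear form. -/
noncomputable def contract (φ : M →ₗ[S] S) : ExteriorAlgebra S M →ₗ[S] ExteriorAlgebra S M :=
  CliffordAlgebra.contractLeft (Q := (0 : QuadraticForm S M)) φ

lemma contract_ι_mul (φ : M →ₗ[S] S) (m : M) (ω : ExteriorAlgebra S M) :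
    contract φ (ι S m * ω) = φ m • ω - ι S m * contract φ ω :=
  CliffordAlgebra.contractLeft_ι_mul ..

lemma contract_algebraMap (φ : M →ₗ[S] S) (a : S) :
    contract φ (algebraMap S (ExteriorAlgebra S M) a) = 0 :=
  CliffordAlgebra.contractLeft_algebraMap (Q := (0 : QuadraticForm S M)) ..

lemma contract_one (φ : M →ₗ[S] S) : contract φ (1 : ExteriorAlgebra S M) = 0 :=
  CliffordAlgebra.contractLeft_one (Q := (0 : QuadraticForm S M)) ..

lemma contract_contract (φ : M →ₗ[S] S) (ω : ExteriorAlgebra S M) :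
    contract φ (contract φ ω) = 0 :=
  CliffordAlgebra.contractLeft_contractLeft (Q := (0 : QuadraticForm S M)) ..

lemma ι_mul_mem (m : M) {n : ℕ} {ω : ExteriorAlgebra S M} (h : ω ∈ ⋀[S]^n M) :
    ι S m * ω ∈ ⋀[S]^(n + 1) M := by
  rw [exteriorPower, pow_succ']
  exact Submodule.mul_mem_mul ⟨m, rfl⟩ h

/-- Induction on the degree of a homogeneous element of the exterior algebra. -/
lemma exteriorPower_induction {p : ℕ → ExteriorAlgebra S M → Prop}
    (h₀ : ∀ a, p 0 (algebraMap S _ a)) (hadd : ∀ n x y, p n x → p n y → p n (x + y))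
    (hmul : ∀ n m x, x ∈ ⋀[S]^n M → p n x → p (n + 1) (ι S m * x))
    {n : ℕ} {ω : ExteriorAlgebra S M} (h : ω ∈ ⋀[S]^n M) : p n ω := by
  induction n generalizing ω with
  | zero =>
    rw [exteriorPower, pow_zero] at h
    obtain ⟨a, rfl⟩ := Submodule.mem_one.1 h
    exact h₀ a
  | succ n ih =>
    rw [exteriorPower, pow_succ'] at h
    induction h using Submodule.mul_induction_on' with
    | mem_mul_mem x hx y hy =>
      obtain ⟨m, rfl⟩ := hx
      exact hmul n m y hy (ih hy)
    | add x _ y _ hx hy => exact hadd _ _ _ hx hy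

lemma contract_mem (φ : M →ₗ[S] S) {n : ℕ} {ω : ExteriorAlgebra S M} (h : ω ∈ ⋀[S]^(n + 1) M) :
    contract φ ω ∈ ⋀[S]^n M := by
  refine exteriorPower_induction
    (p := fun n ω ↦ ∀ k, n = k + 1 → contract φ ω ∈ ⋀[S]^k M) (fun a k hk ↦ by omega)
    (fun n x y hx hy k hk ↦ by rw [map_add]; exact add_mem (hx k hk) (hy k hk))
    (fun n m x hx ih k hk ↦ ?_) h n rfl
  obtain rfl : n = k := by omega
  rw [contract_ι_mul]
  refine sub_mem (Submodule.smul_mem _ _ hx) ?_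
  cases n with
  | zero =>
    rw [exteriorPower, pow_zero] at hx
    obtain ⟨a, rfl⟩ := Submodule.mem_one.1 hx
    rw [contract_algebraMap, mul_zero]
    exact zero_mem _
  | succ n => exact ι_mul_mem m (ih n rfl)

/-- The differential of the Koszul complex of a linear form. -/
noncomputable def koszulD (φ : M →ₗ[S] S) (n : ℕ) : ⋀[S]^(n + 1) M →ₗ[S] ⋀[S]^n M :=
  (contract φ).restrict fun _ h ↦ contract_mem φ h

@[simp] lemma coe_koszulD (φ : M →ₗ[S] S) (n : ℕ) (ω : ⋀[S]^(n + 1) M) :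
    (koszulD φ n ω : ExteriorAlgebra S M) = contract φ ω := rfl

lemma koszulD_koszulD (φ : M →ₗ[S] S) (n : ℕ) (ω : ⋀[S]^(n + 2) M) :
    koszulD φ n (koszulD φ (n + 1) ω) = 0 :=
  Subtype.ext (contract_contract φ _)

variable {I : Ideal S} {n : ℕ}

lemma ι_mul_mem_smul (m : M) {J : Ideal S} {ω : ExteriorAlgebra S M} (h : ω ∈ J • ⋀[S]^n M) :
    ι S m * ω ∈ J • ⋀[S]^(n + 1) M := by
  refine Submodule.smul_induction_on h (fun a ha x hx ↦ ?_) (fun x y hx hy ↦ ?_)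
  · rw [mul_smul_comm]
    exact Submodule.smul_mem_smul ha (ι_mul_mem m hx)
  · rw [mul_add]
    exact add_mem hx hy

lemma ι_mul_mem_smul_of_mem {m : M} {J : Ideal S} (hm : m ∈ J • (⊤ : Submodule S M))
    {ω : ExteriorAlgebra S M} (h : ω ∈ ⋀[S]^n M) :
    ι S m * ω ∈ J • ⋀[S]^(n + 1) M := by
  refine Submodule.smul_induction_on hm (fun a ha x _ ↦ ?_) (fun x y hx hy ↦ ?_)
  · rw [map_smul, smul_mul_assoc]
    exact Submodule.smul_mem_smul ha (ι_mul_mem x h)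
  · rw [map_add, add_mul]
    exact add_mem hx hy

end

variable {R S : Type*} [CommRing R] [CommRing S] [Algebra R S]

/-- The data of an `R`-linear vector field on `S`, with values in `I`, inducing the identity on
`I / I ^ 2`, where `S = R + I`. -/
structure IsEulerForm (R : Type*) {S : Type*} [CommRing R] [CommRing S] [Algebra R S]
    (I : Ideal S) (φ : Ω[S⁄R] →ₗ[S] S) : Prop where
  mem : ∀ ω, φ ω ∈ I
  sub_mem : ∀ x ∈ I, φ (D R S x) - x ∈ I ^ 2
  exists_sub_mem : ∀ x : S, ∃ r : R, x - algebraMap R S r ∈ I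

variable {I : Ideal S} {φ : Ω[S⁄R] →ₗ[S] S}

lemma D_mem_of_mem_sq {x : S} (hx : x ∈ I ^ 2) : D R S x ∈ I • (⊤ : Submodule S (Ω[S⁄R])) := by
  rw [pow_two] at hx
  induction hx using Submodule.mul_induction_on' with
  | mem_mul_mem x hx y hy =>
    rw [Derivation.leibniz]
    exact add_mem (Submodule.smul_mem_smul hx trivial) (Submodule.smul_mem_smul hy trivial)
  | add x _ y _ hx hy => rw [map_add]; exact add_mem hx hy

lemma IsEulerForm.D_sub_mem (h : IsEulerForm R I φ) (x : S) :
    D R S (φ (D R S x)) - D R S x ∈ I • (⊤ : Submodule S (Ω[S⁄R])) := by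
  obtain ⟨r, hr⟩ := h.exists_sub_mem x
  have := D_mem_of_mem_sq (R := R) (h.sub_mem _ hr)
  simpa only [map_sub, Derivation.map_algebraMap, sub_zero] using this

lemma D_induction {p : Ω[S⁄R] → Prop} (hadd : ∀ x y, p x → p y → p (x + y))
    (hsmul : ∀ (a b : S), p (a • D R S b)) (m : Ω[S⁄R]) : p m := by
  have hm : m ∈ Submodule.span S (Set.range (D R S)) := by
    rw [span_range_derivation]; trivial
  refine Submodule.closure_induction (p := fun m _ ↦ p m)
    (by simpa using hsmul 0 0) (fun x y _ _ ↦ hadd x y) ?_ hm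
  rintro a _ ⟨b, rfl⟩
  exact hsmul a b

section Cartan

variable {d : ExteriorAlgebra S (Ω[S⁄R]) →+ ExteriorAlgebra S (Ω[S⁄R])} (hd₁ : d 1 = 0)
  (hd₂ : ∀ (a : S) ω, d (a • ω) = ι S (D R S a) * ω + a • d ω)
  (hd₃ : ∀ (x : S) ω, d (ι S (D R S x) * ω) = - (ι S (D R S x) * d ω))

include hd₂ in
lemma lie_smul (a : S) (ω : ExteriorAlgebra S (Ω[S⁄R])) :
    contract φ (d (a • ω)) + d (contract φ (a • ω)) =
      φ (D R S a) • ω + a • (contract φ (d ω) + d (contract φ ω)) := by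
  rw [hd₂, map_smul, hd₂, map_add, map_smul, contract_ι_mul, smul_add]
  abel

include hd₂ hd₃ in
lemma lie_ι_mul (x : S) (ω : ExteriorAlgebra S (Ω[S⁄R])) :
    contract φ (d (ι S (D R S x) * ω)) + d (contract φ (ι S (D R S x) * ω)) =
      ι S (D R S (φ (D R S x))) * ω +
        ι S (D R S x) * (contract φ (d ω) + d (contract φ ω)) := by
  rw [hd₃, contract_ι_mul, map_sub, hd₂, hd₃, map_neg, contract_ι_mul, mul_add]
  abel

include hd₁ hd₂ hd₃ in
lemma d_mem {n : ℕ} {ω : ExteriorAlgebra S (Ω[S⁄R])} (h : ω ∈ ⋀[S]^n (Ω[S⁄R])) :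
    d ω ∈ ⋀[S]^(n + 1) (Ω[S⁄R]) := by
  refine exteriorPower_induction (p := fun n ω ↦ d ω ∈ ⋀[S]^(n + 1) (Ω[S⁄R])) (fun a ↦ ?_)
    (fun n x y hx hy ↦ by rw [map_add]; exact add_mem hx hy) (fun n m x hx ih ↦ ?_) h
  · rw [Algebra.algebraMap_eq_smul_one, hd₂, hd₁, smul_zero, add_zero]
    exact ι_mul_mem _ (by rw [exteriorPower, pow_zero]; exact Submodule.one_le.1 le_rfl)
  · induction m using D_induction with
    | hadd x y hx hy => rw [map_add, add_mul, map_add]; exact add_mem hx hy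
    | hsmul a b =>
      rw [map_smul, smul_mul_assoc, hd₂, hd₃]
      exact add_mem (ι_mul_mem _ (ι_mul_mem _ hx))
        (Submodule.smul_mem _ _ (neg_mem (ι_mul_mem _ ih)))

include hd₁ hd₂ hd₃ in
lemma lie_sub_mem (hφ : IsEulerForm R I φ) {n : ℕ} {ω : ExteriorAlgebra S (Ω[S⁄R])}
    (h : ω ∈ ⋀[S]^n (Ω[S⁄R])) :
    contract φ (d ω) + d (contract φ ω) - n • ω ∈ I • ⋀[S]^n (Ω[S⁄R]) := by
  refine exteriorPower_induction
    (p := fun n ω ↦ contract φ (d ω) + d (contract φ ω) - n • ω ∈ I • ⋀[S]^n (Ω[S⁄R]))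
    (fun a ↦ ?_) (fun n x y hx hy ↦ ?_) (fun n m x hx ih ↦ ?_) h
  · rw [Algebra.algebraMap_eq_smul_one, lie_smul hd₂, hd₁, contract_one, map_zero, map_zero,
      add_zero, smul_zero, add_zero, zero_smul, sub_zero]
    refine Submodule.smul_mem_smul (hφ.mem _) ?_
    rw [exteriorPower, pow_zero]; exact Submodule.one_le.1 le_rfl
  · convert add_mem hx hy using 1
    simp only [map_add, smul_add]
    abel
  · induction m using D_induction with
    | hadd y z hy hz =>
      convert add_mem hy hz using 1
      simp only [map_add, smul_add, add_mul]
      abel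
    | hsmul a b =>
      have h₁ := Submodule.smul_mem _ a (ι_mul_mem_smul (D R S b) ih)
      have h₂ := Submodule.smul_mem _ a (ι_mul_mem_smul_of_mem (hφ.D_sub_mem b) hx)
      have h₃ := Submodule.smul_mem_smul (hφ.mem (D R S a)) (ι_mul_mem (D R S b) hx)
      convert add_mem (add_mem h₁ h₂) h₃ using 1
      rw [map_smul, smul_mul_assoc, lie_smul hd₂, lie_ι_mul hd₂ hd₃, map_sub, sub_mul, mul_sub,
        ← Nat.cast_smul_eq_nsmul S, ← Nat.cast_smul_eq_nsmul S, mul_smul_comm]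
      push_cast
      module

include hd₁ hd₂ hd₃ in
lemma lie_sub_mem_pow (hφ : IsEulerForm R I φ) {n : ℕ} (m : ℕ) {ω : ExteriorAlgebra S (Ω[S⁄R])}
    (h : ω ∈ I ^ m • ⋀[S]^n (Ω[S⁄R])) :
    contract φ (d ω) + d (contract φ ω) - (m + n) • ω ∈ I ^ (m + 1) • ⋀[S]^n (Ω[S⁄R]) := by
  induction m generalizing ω with
  | zero =>
    rw [pow_zero, Ideal.one_eq_top, Submodule.top_smul] at h
    rw [zero_add, zero_add, pow_one]
    exact lie_sub_mem hd₁ hd₂ hd₃ hφ h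
  | succ m ih =>
    rw [pow_succ', ← smul_eq_mul, Submodule.smul_assoc] at h
    refine Submodule.smul_induction_on h (fun a ha x hx ↦ ?_) (fun x y hx hy ↦ ?_)
    · have h₁ : a • (contract φ (d x) + d (contract φ x) - (m + n) • x) ∈
          I ^ (m + 1 + 1) • ⋀[S]^n (Ω[S⁄R]) := by
        rw [pow_succ' _ (m + 1), ← smul_eq_mul, Submodule.smul_assoc]
        exact Submodule.smul_mem_smul ha (ih hx)
      have h₂ : (φ (D R S a) - a) • x ∈ I ^ (m + 1 + 1) • ⋀[S]^n (Ω[S⁄R]) := by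
        rw [show m + 1 + 1 = 2 + m by omega, pow_add, ← smul_eq_mul, Submodule.smul_assoc]
        exact Submodule.smul_mem_smul (hφ.sub_mem a ha) hx
      convert add_mem h₁ h₂ using 1
      rw [lie_smul hd₂, ← Nat.cast_smul_eq_nsmul S, ← Nat.cast_smul_eq_nsmul S]
      push_cast
      module
    · convert add_mem hx hy using 1
      simp only [map_add, smul_add]
      abel

end Cartan

end Contraction

section Exactness

open ExteriorAlgebra KaehlerDifferential Pointwise

variable {R S : Type*} [CommRing R] [CommRing S] [Algebra R S]
  {I : Ideal S} {φ : Ω[S⁄R] →ₗ[S] S}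

lemma koszulD_ker_le (hS : ∀ n : ℕ, n ≠ 0 → IsUnit (n : S)) (hφ : IsEulerForm R I φ) (n m : ℕ) :
    LinearMap.ker (koszulD φ n) ≤ LinearMap.range (koszulD φ (n + 1)) ⊔
      (I ^ m • ⊤ ⊓ LinearMap.ker (koszulD φ n)) := by
  obtain ⟨d, hd₁, hd₂, hd₃⟩ := exists_exteriorDerivative R S
  induction m with
  | zero => simp
  | succ m ih =>
    refine ih.trans (sup_le le_sup_left ?_)
    rintro z ⟨hz, hz₀⟩
    have hz₁ : contract φ (z : ExteriorAlgebra S (Ω[S⁄R])) = 0 := congrArg Subtype.val hz₀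
    obtain ⟨u, hu⟩ := hS (m + (n + 1)) (by omega)
    let w : ⋀[S]^(n + 2) (Ω[S⁄R]) := ⟨d z, d_mem hd₁ hd₂ hd₃ z.2⟩
    let y := koszulD φ (n + 1) ((↑u⁻¹ : S) • w)
    have hy : koszulD φ n y = 0 := koszulD_koszulD ..
    refine Submodule.mem_sup.2 ⟨y, ⟨_, rfl⟩, z - y, ⟨?_, ?_⟩, add_sub_cancel _ _⟩
    · have h := lie_sub_mem_pow hd₁ hd₂ hd₃ hφ m ((Submodule.mem_smul_top_iff _ _ _).1 hz)
      rw [hz₁, map_zero, add_zero] at h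
      refine (Submodule.mem_smul_top_iff _ _ _).2 ?_
      convert Submodule.smul_mem _ (-(↑u⁻¹ : S)) h using 1
      rw [← Nat.cast_smul_eq_nsmul S, ← hu, smul_sub, neg_smul, neg_smul, smul_smul, u.inv_mul,
        one_smul]
      simp only [y, w, AddSubgroupClass.coe_sub, coe_koszulD, SetLike.val_smul, map_smul]
      abel
    · exact sub_mem hz₀ hy

lemma smul_ker_koszulD_le (h : I ≤ LinearMap.range φ) (n : ℕ) :
    I • LinearMap.ker (koszulD φ n) ≤ LinearMap.range (koszulD φ (n + 1)) := by
  refine Submodule.smul_le.2 fun a ha z hz ↦ ?_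
  obtain ⟨m, rfl⟩ := h ha
  have hz₁ : contract φ (z : ExteriorAlgebra S (Ω[S⁄R])) = 0 := congrArg Subtype.val hz
  refine ⟨⟨ι S m * z, ι_mul_mem m z.2⟩, Subtype.ext ?_⟩
  rw [coe_koszulD, contract_ι_mul, hz₁, mul_zero, sub_zero]
  rfl

theorem koszulD_exact [IsNoetherianRing S] [Module.Finite S (Ω[S⁄R])]
    (hS : ∀ n : ℕ, n ≠ 0 → IsUnit (n : S)) (hφ : IsEulerForm R I φ)
    (h : I ≤ LinearMap.range φ) (n : ℕ) :
    Function.Exact (koszulD φ (n + 1)) (koszulD φ n) := by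
  rw [LinearMap.exact_iff]
  refine le_antisymm ?_ ?_
  · obtain ⟨k, hk⟩ := I.exists_pow_inf_eq_pow_smul (LinearMap.ker (koszulD φ n))
    refine (koszulD_ker_le hS hφ n (k + 1)).trans (sup_le le_rfl ?_)
    rw [hk _ (Nat.le_succ k), show k.succ - k = 1 by omega, pow_one]
    exact (Submodule.smul_mono le_rfl inf_le_right).trans (smul_ker_koszulD_le h n)
  · rintro _ ⟨z, rfl⟩
    exact koszulD_koszulD ..

end Exactness

section EulerForm

open KaehlerDifferential

variable {R S : Type*} [CommRing R] [CommRing S] [Algebra R S] (ε : S →ₐ[R] R)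

lemma sub_algebraMap_mem_ker (s : S) : s - algebraMap R S (ε s) ∈ RingHom.ker ε := by
  simp [RingHom.mem_ker]

/-- The derivation `s ↦ s - ε s` with values in the conormal module of an augmentation `ε`. -/
noncomputable def cotangentDerivation : Derivation R S (RingHom.ker ε).Cotangent :=
  Derivation.mk'
    ((RingHom.ker ε).toCotangent.restrictScalars R ∘ₗ
      LinearMap.codRestrict ((RingHom.ker ε).restrictScalars R)
        (LinearMap.id - (Algebra.linearMap R S ∘ₗ ε.toLinearMap)) (sub_algebraMap_mem_ker ε))
    (fun s t ↦ by
      change (RingHom.ker ε).toCotangent ⟨_, _⟩ = s • (RingHom.ker ε).toCotangent ⟨_, _⟩ +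
        t • (RingHom.ker ε).toCotangent ⟨_, _⟩
      rw [← map_smul, ← map_smul, ← map_add, Ideal.toCotangent_eq]
      have h := neg_mem (Ideal.mul_mem_mul (sub_algebraMap_mem_ker ε s)
        (sub_algebraMap_mem_ker ε t))
      rw [← pow_two] at h
      convert h using 1
      simp only [LinearMap.sub_apply, LinearMap.id_apply, LinearMap.comp_apply,
        AlgHom.toLinearMap_apply, Algebra.linearMap_apply, Submodule.coe_add,
        SetLike.val_smul, smul_eq_mul, map_mul]
      ring)

lemma cotangentDerivation_apply (s : S) : cotangentDerivation ε s =
    (RingHom.ker ε).toCotangent ⟨s - algebraMap R S (ε s), sub_algebraMap_mem_ker ε s⟩ := rfl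

theorem exists_isEulerForm [Module.Projective S (Ω[S⁄R])]
    (hfg : (RingHom.ker ε).FG) (hjac : RingHom.ker ε ≤ Ideal.jacobson ⊥) :
    ∃ φ : Ω[S⁄R] →ₗ[S] S, IsEulerForm R (RingHom.ker ε) φ ∧
      LinearMap.range φ = RingHom.ker ε := by
  obtain ⟨h, hh⟩ := Module.projective_lifting_property (RingHom.ker ε).toCotangent
    (cotangentDerivation ε).liftKaehlerDifferential (Ideal.toCotangent_surjective _)
  have hφ : IsEulerForm R (RingHom.ker ε) ((RingHom.ker ε).subtype ∘ₗ h) := by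
    refine ⟨fun ω ↦ (h ω).2, fun x hx ↦ ?_, fun x ↦ ⟨_, sub_algebraMap_mem_ker ε x⟩⟩
    have := LinearMap.congr_fun hh (D R S x)
    rw [Derivation.liftKaehlerDifferential_comp_D, LinearMap.comp_apply,
      cotangentDerivation_apply, Ideal.toCotangent_eq] at this
    simpa [RingHom.mem_ker.1 hx] using this
  refine ⟨_, hφ, le_antisymm ?_ ?_⟩
  · rintro _ ⟨ω, rfl⟩
    exact hφ.mem ω
  · refine Submodule.le_of_le_smul_of_le_jacobson_bot hfg hjac fun x hx ↦ ?_
    rw [smul_eq_mul, ← pow_two]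
    refine Submodule.mem_sup.2 ⟨_, ⟨D R S x, rfl⟩, _, neg_mem (hφ.sub_mem x hx), by abel⟩

end EulerForm

section Projective

open KaehlerDifferential

variable {S M N : Type*} [CommRing S] [AddCommGroup M] [Module S M]

instance exteriorPower_projective [Module.Projective S M] (n : ℕ) :
    Module.Projective S (⋀[S]^n M) := by
  obtain ⟨i, hi⟩ := Module.projective_def'.1 (inferInstance : Module.Projective S M)
  refine Module.Projective.of_split (exteriorPower.map n i)
    (exteriorPower.map n (Finsupp.linearCombination S id)) ?_
  rw [← exteriorPower.map_comp, hi, exteriorPower.map_id]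

end Projective

section LocalizedAugmentation

variable {A B : Type*} [CommRing A] [CommRing B] [Algebra A B] (ε : B →ₐ[A] A)

/-- The localization of an augmented algebra along the augmentation section. -/
abbrev AugLoc : Type _ := Localization (MonoidHom.mker ε)

/-- The augmentation of the localization of an augmented algebra. -/
noncomputable def augLoc : AugLoc ε →ₐ[A] A :=
  IsLocalization.liftAlgHom (M := MonoidHom.mker ε) (f := ε) fun y ↦ by
    rw [show ε y = 1 from y.2]; exact isUnit_one

@[simp] lemma augLoc_algebraMap (b : B) : augLoc ε (algebraMap B (AugLoc ε) b) = ε b :=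
  IsLocalization.lift_eq ..

lemma isUnit_of_augLoc_eq_one {s : AugLoc ε} (h : augLoc ε s = 1) : IsUnit s := by
  obtain ⟨b, m, rfl⟩ := IsLocalization.exists_mk'_eq (MonoidHom.mker ε) s
  have h₁ : ε b = 1 := by
    have := IsLocalization.mk'_spec (AugLoc ε) b m
    apply_fun augLoc ε at this
    rw [map_mul, h, augLoc_algebraMap, augLoc_algebraMap, show ε m = 1 from m.2, one_mul] at this
    exact this.symm
  rw [IsLocalization.mk'_eq_mul_mk'_one]
  refine (IsLocalization.map_units (AugLoc ε) (⟨b, h₁⟩ : MonoidHom.mker ε)).mul ?_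
  refine IsUnit.of_mul_eq_one (algebraMap B _ m) ?_
  rw [IsLocalization.mk'_spec, map_one]

lemma ker_augLoc_le_jacobson : RingHom.ker (augLoc ε) ≤ Ideal.jacobson ⊥ := fun x hx ↦ by
  rw [Ideal.mem_jacobson_bot]
  intro y
  exact isUnit_of_augLoc_eq_one ε (by rw [map_add, map_mul, RingHom.mem_ker.1 hx]; simp)

end LocalizedAugmentation

section TensorSelf

variable (k A : Type*) [Field k] [CommRing A] [Algebra k A]

/-- The multiplication map, as an augmentation of the left `A`-algebra `A ⊗[k] A`. -/
noncomputable abbrev mulAug : A ⊗[k] A →ₐ[A] A := Algebra.TensorProduct.lmul'' k (S := A)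

/-- The localization of `A ⊗[k] A` around the diagonal. -/
abbrev DiagLoc : Type _ := AugLoc (mulAug k A)

instance [Algebra.FiniteType k A] : IsNoetherianRing (DiagLoc k A) := by
  have : Algebra.FiniteType k (A ⊗[k] A) :=
    .trans (S := A) inferInstance inferInstance
  have := Algebra.FiniteType.isNoetherianRing k (A ⊗[k] A)
  exact IsLocalization.isNoetherianRing (MonoidHom.mker (mulAug k A)) _ this

instance [Algebra.FormallySmooth k A] : Algebra.FormallySmooth A (DiagLoc k A) := by
  have : Algebra.FormallySmooth (A ⊗[k] A) (DiagLoc k A) := .of_isLocalization (MonoidHom.mker (mulAug k A))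
  exact .comp A (A ⊗[k] A) (DiagLoc k A)

instance [Algebra.FiniteType k A] : Algebra.EssFiniteType A (DiagLoc k A) := by
  have : Algebra.EssFiniteType (A ⊗[k] A) (DiagLoc k A) := .of_isLocalization _ (MonoidHom.mker (mulAug k A))
  exact .comp A (A ⊗[k] A) (DiagLoc k A)

lemma isUnit_natCast_diagLoc [CharZero k] (n : ℕ) (hn : n ≠ 0) : IsUnit (n : DiagLoc k A) := by
  have : IsUnit (n : k) := (Nat.cast_ne_zero.2 hn).isUnit
  simpa using this.map (algebraMap k (A ⊗[k] A)) |>.map (algebraMap (A ⊗[k] A) (DiagLoc k A))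

theorem exists_koszul_resolution [CharZero k] [Algebra.Smooth k A] :
    ∃ φ : Ω[DiagLoc k A⁄A] →ₗ[DiagLoc k A] DiagLoc k A,
      LinearMap.range φ = RingHom.ker (augLoc (mulAug k A)) ∧
      ∀ n, Function.Exact (koszulD φ (n + 1)) (koszulD φ n) := by
  have := Algebra.FormallySmooth.projective_kaehlerDifferential (R := A) (A := DiagLoc k A)
  obtain ⟨φ, hφ, h⟩ := exists_isEulerForm (augLoc (mulAug k A)) (IsNoetherian.noetherian _)
    (ker_augLoc_le_jacobson _)
  exact ⟨φ, h, koszulD_exact (isUnit_natCast_diagLoc k A) hφ h.ge⟩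

end TensorSelf

section Resolution

open CategoryTheory.Limits

variable {S : Type u} [CommRing S] (P : ℕ → Type u) [∀ n, AddCommGroup (P n)]
  [∀ n, Module S (P n)] (d : ∀ n, P (n + 1) →ₗ[S] P n)

/-- The chain complex of a sequence of exact linear maps. -/
noncomputable def complexOfExact (hd : ∀ n, Function.Exact (d (n + 1)) (d n)) :
    ChainComplex (ModuleCat.{u} S) ℕ :=
  ChainComplex.of (fun n ↦ ModuleCat.of S (P n)) (fun n ↦ ModuleCat.ofHom (d n))
    (fun n ↦ by ext x; exact (hd n).apply_apply_eq_zero x)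

lemma complexOfExact_d (hd : ∀ n, Function.Exact (d (n + 1)) (d n)) (n : ℕ) :
    (complexOfExact P d hd).d (n + 1) n = ModuleCat.ofHom (d n) := by
  simp only [complexOfExact, ChainComplex.of_d]

variable {Y : Type u} [AddCommGroup Y] [Module S Y] (π : P 0 →ₗ[S] Y)

/-- The projective resolution of a module given by a sequence of exact linear maps. -/
noncomputable def resolutionOfExact [∀ n, Module.Projective S (P n)]
    (hd : ∀ n, Function.Exact (d (n + 1)) (d n)) (h₀ : Function.Exact (d 0) π)
    (hπ : Function.Surjective π) :
    ProjectiveResolution (ModuleCat.of S Y) where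
  complex := complexOfExact P d hd
  projective n := by
    change Projective (ModuleCat.of S (P n))
    infer_instance
  π := (ChainComplex.toSingle₀Equiv _ _).symm ⟨ModuleCat.ofHom π, by
    rw [complexOfExact_d]
    ext x
    exact h₀.apply_apply_eq_zero x⟩
  quasiIso := ⟨fun n ↦ by
    cases n with
    | zero =>
      rw [ChainComplex.quasiIsoAt₀_iff, ShortComplex.quasiIso_iff_of_zeros']
      · refine (ShortComplex.exact_and_epi_g_iff_of_iso
          (S₂ := ShortComplex.mk (ModuleCat.ofHom (d 0)) (ModuleCat.ofHom π)
            (by ext x; exact h₀.apply_apply_eq_zero x)) ?_).2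
          ⟨(ShortComplex.ShortExact.moduleCat_exact_iff_function_exact _).2 h₀,
            (ModuleCat.epi_iff_surjective _).2 hπ⟩
        refine ShortComplex.isoMk (Iso.refl _) (Iso.refl _) (Iso.refl _)
          ?_ ?_
        · refine (Category.id_comp _).trans (Eq.trans ?_ (Category.comp_id _).symm)
          exact (complexOfExact_d P d hd 0).symm
        · refine (Category.id_comp _).trans (Eq.trans ?_ (Category.comp_id _).symm)
          exact (ChainComplex.toSingle₀Equiv_symm_apply_f_zero (C := complexOfExact P d hd)
            (X := ModuleCat.of S Y) (ModuleCat.ofHom π) _).symm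
      all_goals rfl
    | succ n =>
      rw [quasiIsoAt_iff_exactAt']
      · rw [HomologicalComplex.exactAt_iff' _ (n + 1 + 1) (n + 1) n (by simp) (by simp)]
        rw [ShortComplex.ShortExact.moduleCat_exact_iff_function_exact]
        change Function.Exact ((complexOfExact P d hd).d (n + 2) (n + 1))
          ((complexOfExact P d hd).d (n + 1) n)
        rw [complexOfExact_d, complexOfExact_d]
        exact hd n
      · apply ChainComplex.exactAt_succ_single_obj⟩

end Resolution

section LeftDerived

variable {C C' D : Type*} [Category* C] [Category* C'] [Category* D] [Abelian C] [Abelian C']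
  [Abelian D] [HasProjectiveResolutions C] [HasProjectiveResolutions C']

/-- Left derived functors may be computed after an exact functor preserving projectives. -/
noncomputable def leftDerivedObjIsoOfExact (F : C ⥤ D) [F.Additive] (L : C ⥤ C') [L.Additive]
    [L.PreservesHomology] [L.PreservesProjectiveObjects] (G : C' ⥤ D) [G.Additive] (e : F ≅ L ⋙ G)
    (X : C) (n : ℕ) :
    (F.leftDerived n).obj X ≅ (G.leftDerived n).obj (L.obj X) :=
  let Q := projectiveResolution X
  Q.isoLeftDerivedObj F n ≪≫
    (HomologicalComplex.homologyFunctor D _ n).mapIso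
      ((NatIso.mapHomologicalComplex e _).app Q.complex) ≪≫
    ((L.mapProjectiveResolution Q).isoLeftDerivedObj G n).symm

/-- A left derived functor is computed by a resolution on whose image the differentials vanish. -/
noncomputable def leftDerivedObjIsoOfMapEqZero (G : C' ⥤ D) [G.Additive] {Y : C'}
    (P : ProjectiveResolution Y) (h : ∀ i j, G.map (P.complex.d i j) = 0) (n : ℕ) :
    (G.leftDerived n).obj Y ≅ G.obj (P.complex.X n) :=
  P.isoLeftDerivedObj G n ≪≫
    (ShortComplex.HomologyData.ofZeros (((G.mapHomologicalComplex _).obj P.complex).sc n)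
      (h _ _) (h _ _)).left.homologyIso

end LeftDerived

section TorLocalization

open MonoidalCategory

variable {B : Type u} [CommRing B] (M : Submonoid B)

lemma lTensor_bijective_of_isLocalizedModule (X : Type*) {Y Z : Type*} [AddCommGroup X]
    [AddCommGroup Y] [AddCommGroup Z] [Module B X] [Module B Y] [Module B Z]
    [Module (Localization M) X] [IsScalarTower B (Localization M) X] (u : Y →ₗ[B] Z)
    [IsLocalizedModule M u] : Function.Bijective (u.lTensor X) := by
  have h₁ : IsLocalizedModule M (LinearMap.id : X ⊗[B] Y →ₗ[B] X ⊗[B] Y) :=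
    isLocalizedModule_id M _ (Localization M)
  have h₂ : IsLocalizedModule M (u.lTensor X) := by
    have h : IsLocalizedModule M (u.rTensor X) := 
      IsLocalizedModule.rTensor B M u
    rw [← LinearMap.comm_comp_rTensor_comp_comm_eq]
    infer_instance
  rw [← IsLocalizedModule.linearEquiv_of_isLocalizedModule_comp M LinearMap.id (u.lTensor X)]
  exact (IsLocalizedModule.linearEquiv ..).bijective

/-- Restricting scalars along `algebraMap` does not change compatible module structures. -/
def restrictScalarsEquiv (S : Type u) [CommRing S] [Algebra B S] (W : ModuleCat.{u} S)
    [Module B W] [IsScalarTower B S W] :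
    W ≃ₗ[B] (ModuleCat.restrictScalars (algebraMap B S)).obj W where
  toFun x := x
  invFun x := x
  map_add' _ _ := rfl
  map_smul' b x := (algebraMap_smul S b x).symm
  left_inv _ := rfl
  right_inv _ := rfl

/-- The localization map of a module, viewed as a morphism of modules over the base ring. -/
noncomputable def toLocalizedModule (Y : ModuleCat.{u} B) :
    Y ⟶ (ModuleCat.restrictScalars (algebraMap B (Localization M))).obj
      ((ModuleCat.localizedModuleFunctor M).obj Y) :=
  ConcreteCategory.ofHom ((restrictScalarsEquiv (Localization M) (Y.localizedModule M)).toLinearMap ∘ₗ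
    Y.localizedModuleMkLinearMap M)

instance (Y : ModuleCat.{u} B) : IsLocalizedModule M (toLocalizedModule M Y).hom := by
  change IsLocalizedModule M ((restrictScalarsEquiv (Localization M)
    (Y.localizedModule M)).toLinearMap ∘ₗ Y.localizedModuleMkLinearMap M)
  infer_instance

lemma toLocalizedModule_naturality {Y Z : ModuleCat.{u} B} (f : Y ⟶ Z) :
    f ≫ toLocalizedModule M Z = toLocalizedModule M Y ≫
      (ModuleCat.restrictScalars (algebraMap B (Localization M))).map
        ((ModuleCat.localizedModuleFunctor M).map f) := by
  ext y
  exact (IsLocalizedModule.map_apply M (Y.localizedModuleMkLinearMap M)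
    (Z.localizedModuleMkLinearMap M) f.hom y).symm

/-- Tensoring with a module over a localization factors through the localization. -/
noncomputable def tensoringLeftIso (X : Type u) [AddCommGroup X] [Module B X]
    [Module (Localization M) X] [IsScalarTower B (Localization M) X] :
    (tensoringLeft (ModuleCat.{u} B)).obj (ModuleCat.of B X) ≅
      ModuleCat.localizedModuleFunctor M ⋙
        ModuleCat.restrictScalars (algebraMap B (Localization M)) ⋙
          (tensoringLeft (ModuleCat.{u} B)).obj (ModuleCat.of B X) :=
  NatIso.ofComponents (fun Y ↦
      @asIso _ _ _ _ (ModuleCat.of B X ◁ toLocalizedModule M Y) (by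
        refine (ConcreteCategory.isIso_iff_bijective (ModuleCat.of B X ◁ toLocalizedModule M Y)).2 ?_
        exact lTensor_bijective_of_isLocalizedModule M X (toLocalizedModule M Y).hom))
    (fun f ↦ (MonoidalCategory.whiskerLeft_comp ..).symm.trans
      ((congrArg (ModuleCat.of B X ◁ ·) (toLocalizedModule_naturality M f)).trans
        (MonoidalCategory.whiskerLeft_comp ..)))

/-- A module over a localization is its own localization. -/
noncomputable def localizedModuleFunctorObjIso (Y : ModuleCat.{u} B)
    [Module (Localization M) Y] [IsScalarTower B (Localization M) Y] :
    (ModuleCat.localizedModuleFunctor M).obj Y ≅ ModuleCat.of (Localization M) Y :=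
  have : IsLocalizedModule M (LinearMap.id : Y →ₗ[B] Y) :=
    isLocalizedModule_id M _ (Localization M)
  LinearEquiv.toModuleIso ((IsLocalizedModule.linearEquiv M (Y.localizedModuleMkLinearMap M)
    (LinearMap.id : Y →ₗ[B] Y)).extendScalarsOfIsLocalization M (Localization M))

theorem nonempty_tor_linearEquiv (X Y : Type u) [AddCommGroup X] [Module B X]
    [Module (Localization M) X] [IsScalarTower B (Localization M) X]
    [AddCommGroup Y] [Module B Y]
    [Module (Localization M) Y] [IsScalarTower B (Localization M) Y]
    (P : ℕ → Type u) [∀ n, AddCommGroup (P n)] [∀ n, Module B (P n)]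
    [∀ n, Module (Localization M) (P n)] [∀ n, IsScalarTower B (Localization M) (P n)]
    [∀ n, Module.Projective (Localization M) (P n)]
    (d : ∀ n, P (n + 1) →ₗ[Localization M] P n) (π : P 0 →ₗ[Localization M] Y)
    (hd : ∀ n, Function.Exact (d (n + 1)) (d n)) (h₀ : Function.Exact (d 0) π)
    (hπ : Function.Surjective π) (hX : ∀ n (x : X) p, x ⊗ₜ[B] d n p = 0) (n : ℕ) :
    Nonempty (((Tor (ModuleCat.{u} B) n).obj (ModuleCat.of B X)).obj (ModuleCat.of B Y) ≃ₗ[B]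
      X ⊗[B] P n) := by
  let G := ModuleCat.restrictScalars (algebraMap B (Localization M)) ⋙
          (tensoringLeft (ModuleCat.{u} B)).obj (ModuleCat.of B X)
  have hG : ∀ i j, G.map ((resolutionOfExact P d π hd h₀ hπ).complex.d i j) = 0 := fun i j ↦ by
    by_cases h : j + 1 = i
    · subst h
      change G.map ((complexOfExact P d hd).d (j + 1) j) = 0
      rw [complexOfExact_d]
      ext z
      refine TensorProduct.induction_on z (map_zero _) (fun x p ↦ ?_) fun y z hy hz ↦ ?_
      · refine (TensorProduct.congr (.refl B X) (restrictScalarsEquiv (Localization M)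
          (ModuleCat.of (Localization M) (P j))).symm).injective ?_
        exact (hX j x p).trans (map_zero _).symm
      · rw [map_add, hy, hz]
        rfl
    · rw [HomologicalComplex.shape _ _ _ h, Functor.map_zero]
  let e₁ := leftDerivedObjIsoOfExact _ _ G (tensoringLeftIso M X) (ModuleCat.of B Y) n ≪≫
    (G.leftDerived n).mapIso (localizedModuleFunctorObjIso M (ModuleCat.of B Y)) ≪≫
    leftDerivedObjIsoOfMapEqZero G (resolutionOfExact P d π hd h₀ hπ) hG n
  exact ⟨e₁.toLinearEquiv ≪≫ₗ TensorProduct.congr (.refl B X)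
    (restrictScalarsEquiv (Localization M) (ModuleCat.of (Localization M) (P n))).symm⟩

end TorLocalization

section Descent

variable {S A P Q N : Type*} [CommRing S] [CommRing A] [Algebra S A] [AddCommGroup P]
  [AddCommGroup Q] [AddCommGroup N] [Module S P] [Module S Q]
  [Module S N] [Module A N] [IsScalarTower S A N] {n : ℕ} {g : P →ₗ[S] Q}
  (hA : Function.Surjective (algebraMap S A)) (hg : Function.Surjective g)
  (hker : LinearMap.ker g ≤ RingHom.ker (algebraMap S A) • ⊤)

include hker in
lemma map_eq_of_map_eq (f : P →ₗ[S] N) {x y : P} (h : g x = g y) : f x = f y := by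
  have hle : RingHom.ker (algebraMap S A) • ⊤ ≤ LinearMap.ker f :=
    Submodule.smul_le.2 fun s hs p _ ↦ by
      rw [LinearMap.mem_ker, map_smul, ← algebraMap_smul A, RingHom.mem_ker.1 hs, zero_smul]
  have := hle (hker (LinearMap.mem_ker.2 (by rw [map_sub, h, sub_self] : g (x - y) = 0)))
  rwa [LinearMap.mem_ker, map_sub, sub_eq_zero] at this

include hker in
lemma alternatingMap_congr (F : P [⋀^Fin n]→ₗ[S] N) {v w : Fin n → P}
    (h : ∀ i, g (v i) = g (w i)) : F v = F w := by
  suffices hs : ∀ s : Finset (Fin n), F (s.piecewise v w) = F w by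
    simpa using hs Finset.univ
  intro s
  induction s using Finset.induction_on with
  | empty => simp
  | insert j s hj ih =>
    rw [Finset.piecewise_insert, ← ih]
    have := map_eq_of_map_eq hker (F.toMultilinearMap.toLinearMap (s.piecewise v w) j) (h j)
    refine this.trans ?_
    change F (Function.update _ j (w j)) = _
    rw [← Finset.piecewise_eq_of_notMem s v w hj, Function.update_eq_self]

variable [Module A Q] [IsScalarTower S A Q]

/-- An alternating map with values in an `A`-module descends along a surjection whose kernel is
generated by the kernel of `S → A`. -/
noncomputable def descendAlternating (F : P [⋀^Fin n]→ₗ[S] N) : Q [⋀^Fin n]→ₗ[A] N where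
  toFun v := F fun i ↦ Function.surjInv hg (v i)
  map_update_add' v i x y := by
    rw [alternatingMap_congr hker F (w := Function.update (fun i ↦ Function.surjInv hg (v i)) i
      (Function.surjInv hg x + Function.surjInv hg y)), F.map_update_add]
    · congr 1 <;> refine alternatingMap_congr hker F fun j ↦ ?_ <;>
      · rcases eq_or_ne j i with rfl | hj
        · simp [Function.surjInv_eq]
        · simp [hj]
    · intro j
      rcases eq_or_ne j i with rfl | hj
      · simp [Function.surjInv_eq]
      · simp [hj, Function.surjInv_eq]
  map_update_smul' v i a x := by
    obtain ⟨s, rfl⟩ := hA a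
    rw [alternatingMap_congr hker F (w := Function.update (fun i ↦ Function.surjInv hg (v i)) i
      (s • Function.surjInv hg x)), F.map_update_smul, algebraMap_smul]
    · congr 1
      refine alternatingMap_congr hker F fun j ↦ ?_
      rcases eq_or_ne j i with rfl | hj
      · simp [Function.surjInv_eq]
      · simp [hj]
    · intro j
      rcases eq_or_ne j i with rfl | hj
      · simp [Function.surjInv_eq]
      · simp [hj, Function.surjInv_eq]
  map_eq_zero_of_eq' v i j h hij := F.map_eq_zero_of_eq _ (by rw [h]) hij

lemma descendAlternating_apply (F : P [⋀^Fin n]→ₗ[S] N) (v : Fin n → P) :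
    descendAlternating hA hg hker F (fun i ↦ g (v i)) = F v :=
  alternatingMap_congr hker F fun _ ↦ Function.surjInv_eq ..

/-- The map on exterior powers induced by a linear map compatible with a change of rings. -/
noncomputable def exteriorPowerMap (g : P →ₗ[S] Q) (n : ℕ) : ⋀[S]^n P →ₗ[S] ⋀[A]^n Q :=
  exteriorPower.alternatingMapLinearEquiv
    { ((exteriorPower.ιMulti A n (M := Q)).toMultilinearMap.restrictScalars S).compLinearMap
        (fun _ ↦ g) with
      map_eq_zero_of_eq' := fun v i j h hij ↦
        (exteriorPower.ιMulti A n).map_eq_zero_of_eq (fun i ↦ g (v i)) (by rw [h]) hij }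

lemma exteriorPowerMap_ιMulti (g : P →ₗ[S] Q) (v : Fin n → P) :
    exteriorPowerMap (A := A) g n (exteriorPower.ιMulti S n v) =
      exteriorPower.ιMulti A n fun i ↦ g (v i) := by
  rw [exteriorPowerMap, exteriorPower.alternatingMapLinearEquiv_apply_ιMulti]
  rfl

/-- If `Q` is the base change of `P` along a surjective ring homomorphism `S → A`, then so are their
exterior powers. -/
noncomputable def exteriorPowerTensorEquiv (n : ℕ) : A ⊗[S] ⋀[S]^n P ≃ₗ[A] ⋀[A]^n Q :=
  .ofLinearMap ((exteriorPowerMap g n).liftBaseChange A)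
    (exteriorPower.alternatingMapLinearEquiv (descendAlternating hA hg hker
      ((TensorProduct.mk S A (⋀[S]^n P) 1).compAlternatingMap (exteriorPower.ιMulti S n))))
    (by
      refine exteriorPower.linearMap_ext (AlternatingMap.ext fun v ↦ ?_)
      obtain ⟨w, rfl⟩ : ∃ w : Fin n → P, v = fun i ↦ g (w i) :=
        ⟨fun i ↦ Function.surjInv hg (v i), funext fun i ↦ (Function.surjInv_eq hg (v i)).symm⟩
      simp only [LinearMap.compAlternatingMap_apply, LinearMap.comp_apply, LinearMap.id_apply,
        exteriorPower.alternatingMapLinearEquiv_apply_ιMulti]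
      rw [descendAlternating_apply hA hg hker]
      simp [exteriorPowerMap_ιMulti])
    (by
      refine TensorProduct.AlgebraTensorModule.curry_injective (LinearMap.ext_ring ?_)
      refine exteriorPower.linearMap_ext (AlternatingMap.ext fun v ↦ ?_)
      simp [exteriorPowerMap_ιMulti, descendAlternating_apply])

end Descent

section Diagonal

open KaehlerDifferential

/-- A derivation of `A` extends to the left `A`-algebra `A ⊗[k] A`, by acting on the right factor. -/
lemma exists_derivation_tensorProduct {k A N : Type*} [CommRing k] [CommRing A] [Algebra k A]
    [AddCommGroup N] [Module k N] [Module A N] [IsScalarTower k A N]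
    [mN : Module (A ⊗[k] A) N] [Algebra (A ⊗[k] A) A] [tN : IsScalarTower (A ⊗[k] A) A N]
    (hA : ∀ b : A ⊗[k] A, algebraMap (A ⊗[k] A) A b = Algebra.TensorProduct.lmul'' k (S := A) b)
    (δ : Derivation k A N) :
    ∃ D : Derivation A (A ⊗[k] A) N, ∀ a, D (1 ⊗ₜ a) = δ a := by
  have hN (b : A ⊗[k] A) (x : N) : b • x = Algebra.TensorProduct.lmul'' k (S := A) b • x := by
    rw [← hA, algebraMap_smul]
  have h : ∀ x y : A ⊗[k] A, δ.toLinearMap.liftBaseChange A (x * y) =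
      x • δ.toLinearMap.liftBaseChange A y + y • δ.toLinearMap.liftBaseChange A x := by
    intro x y
    induction x with
    | zero => simp
    | add x x' hx hx' => rw [add_mul, map_add, hx, hx', map_add, add_smul, smul_add]; abel
    | tmul a b =>
      induction y with
      | zero => simp
      | add y y' hy hy' => rw [mul_add, map_add, hy, hy', map_add, add_smul, smul_add]; abel
      | tmul a' b' =>
        rw [Algebra.TensorProduct.tmul_mul_tmul]
        simp only [LinearMap.liftBaseChange_tmul, Derivation.coeFn_coe, Derivation.leibniz, hN]
        have hmul (a b : A) : Algebra.TensorProduct.lmul'' k (S := A) (a ⊗ₜ b) = a * b := rfl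
        simp only [smul_add, smul_smul, hmul]
        congr 2 <;> ring
  exact ⟨Derivation.mk' (δ.toLinearMap.liftBaseChange A) h, fun a ↦ by simp⟩

variable {k A B S : Type*} [CommRing k] [CommRing A] [CommRing B] [CommRing S] [Algebra k A]
  [Algebra k B] [Algebra A B] [Algebra A S] [Algebra B S] [IsScalarTower A B S]
  [Algebra k S] [IsScalarTower k A S] [IsScalarTower k B S]
  [Algebra B A] [IsScalarTower A B A] [Algebra S A] [IsScalarTower B S A] [IsScalarTower A S A]
  (M : Submonoid B) [IsLocalization M S] (ρ : A →ₐ[k] B)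
  (hρ : ∀ a, algebraMap B A (ρ a) = a)
  (hB : ∀ b, b ∈ Submodule.span A (Set.range ρ))
  (D' : Derivation A B Ω[A⁄k]) (hD : ∀ a, D' (ρ a) = D k A a)

include M hρ hB hD in
theorem exists_kaehlerDifferential_reduction : ∃ g : Ω[S⁄A] →ₗ[S] Ω[A⁄k],
    Function.Surjective g ∧ LinearMap.ker g ≤ RingHom.ker (algebraMap S A) • ⊤ := by
  have := Algebra.FormallyEtale.of_isLocalization (Rₘ := S) M
  let g : Ω[S⁄A] →ₗ[S] Ω[A⁄k] :=
    (isBaseChange_of_formallyEtale A B S).lift D'.liftKaehlerDifferential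
  have hg (b : B) : g (D A S (algebraMap B S b)) = D' b := by
    have := (isBaseChange_of_formallyEtale A B S).lift_eq D'.liftKaehlerDifferential (D A B b)
    rwa [map_D, Derivation.liftKaehlerDifferential_comp_D] at this
  let I := RingHom.ker (algebraMap S A)
  let Q := Ω[S⁄A] ⧸ (I • ⊤ : Submodule S Ω[S⁄A])
  have hS (s : S) (q : Q) : s • q = algebraMap S A s • q := by
    obtain ⟨p, rfl⟩ := Submodule.mkQ_surjective _ q
    rw [← algebraMap_smul S (algebraMap S A s), ← map_smul, ← map_smul, ← sub_eq_zero, ← map_sub,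
      ← sub_smul, ← LinearMap.mem_ker, Submodule.ker_mkQ]
    refine Submodule.smul_mem_smul ?_ trivial
    rw [RingHom.mem_ker, map_sub, ← IsScalarTower.algebraMap_apply A S A]
    simp
  have hB' (a : A) : algebraMap S A (algebraMap B S (ρ a)) = a := by
    rw [← IsScalarTower.algebraMap_apply, hρ]
  let c' : Derivation k A Q := Derivation.mk'
    ((Submodule.mkQ (I • ⊤ : Submodule S Ω[S⁄A])).restrictScalars k ∘ₗ
      (D A S).toLinearMap.restrictScalars k ∘ₗ
        (IsScalarTower.toAlgHom k B S).toLinearMap ∘ₗ ρ.toLinearMap) fun a b ↦ by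
    have h (a : A) (p : Q) : a • p = algebraMap B S (ρ a) • p := by rw [hS, hB']
    rw [h, h]
    simp
  let c := c'.liftKaehlerDifferential
  have hc (a : A) : c (D k A a) = Submodule.Quotient.mk (D A S (algebraMap B S (ρ a))) :=
    c'.liftKaehlerDifferential_comp_D a
  have hcg (p : Ω[S⁄A]) : c (g p) = Submodule.Quotient.mk p := by
    have hp : p ∈ Submodule.span S (Set.range <| map A A B S ∘ D A B) := by
      rw [span_range_map_derivation_of_isLocalization A B S M]; trivial
    induction hp using Submodule.span_induction with
    | zero => simp
    | add x y _ _ hx hy => rw [map_add, map_add, hx, hy]; rfl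
    | smul s x _ hx =>
      rw [map_smul, ← algebraMap_smul A s, map_smul, hx, ← hS]; rfl
    | mem x hx =>
      obtain ⟨b, rfl⟩ := hx
      simp only [Function.comp_apply, map_D, hg]
      induction hB b using Submodule.span_induction with
      | zero => simp
      | add x y _ _ hx hy => simp only [map_add, hx, hy]; rfl
      | smul a x _ hx =>
        have h : algebraMap B S (a • x) = a • algebraMap B S x :=
          map_smul (IsScalarTower.toAlgHom A B S) a x
        rw [D'.map_smul, map_smul, hx, h, Derivation.map_smul]; rfl
      | mem x hx =>
        obtain ⟨a, rfl⟩ := hx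
        rw [hD, hc]
  refine ⟨g, fun x ↦ ?_, fun p hp ↦ ?_⟩
  · have hx : x ∈ Submodule.span A (Set.range (D k A)) := by
      rw [span_range_derivation]; trivial
    refine Submodule.span_le (p := (LinearMap.range g).restrictScalars A).2 ?_ hx
    rintro _ ⟨a, rfl⟩
    exact ⟨_, (hg _).trans (hD a)⟩
  · rw [← Submodule.Quotient.mk_eq_zero, ← hcg, LinearMap.mem_ker.1 hp, map_zero]

end Diagonal

section KoszulAugmentation

open ExteriorAlgebra

variable {S A P : Type*} [CommRing S] [CommRing A] [Algebra S A] [AddCommGroup P] [Module S P]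

lemma contract_mem_smul {φ : P →ₗ[S] S} {I : Ideal S} (hφ : ∀ p, φ p ∈ I) {n : ℕ}
    {ω : ExteriorAlgebra S P} (h : ω ∈ ⋀[S]^(n + 1) P) : contract φ ω ∈ I • ⋀[S]^n P := by
  refine exteriorPower_induction
    (p := fun n ω ↦ ∀ k, n = k + 1 → contract φ ω ∈ I • ⋀[S]^k P) (fun a k hk ↦ by omega)
    (fun n x y hx hy k hk ↦ by rw [map_add]; exact add_mem (hx k hk) (hy k hk))
    (fun n m x hx ih k hk ↦ ?_) h n rfl
  obtain rfl : n = k := by omega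
  rw [contract_ι_mul]
  refine sub_mem (Submodule.smul_mem_smul (hφ m) hx) ?_
  cases n with
  | zero =>
    rw [exteriorPower, pow_zero] at hx
    obtain ⟨a, rfl⟩ := Submodule.mem_one.1 hx
    rw [contract_algebraMap, mul_zero]
    exact zero_mem _
  | succ n =>
    have hle : I • ⋀[S]^n P ≤ (I • ⋀[S]^(n + 1) P).comap (LinearMap.mulLeft S (ι S m)) :=
      Submodule.smul_le.2 fun s hs y hy ↦ by
        rw [Submodule.mem_comap, map_smul]
        exact Submodule.smul_mem_smul hs (ι_mul_mem m hy)
    exact hle (ih n rfl)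

lemma tmul_koszulD {φ : P →ₗ[S] S} (hφ : ∀ p, algebraMap S A (φ p) = 0) {n : ℕ} (a : A)
    (ω : ⋀[S]^(n + 1) P) : a ⊗ₜ[S] koszulD φ n ω = 0 := by
  have h : koszulD φ n ω ∈ RingHom.ker (algebraMap S A) • (⊤ : Submodule S (⋀[S]^n P)) := by
    rw [Submodule.mem_smul_top_iff, coe_koszulD]
    exact contract_mem_smul hφ ω.2
  have hle : RingHom.ker (algebraMap S A) • ⊤ ≤
      LinearMap.ker (TensorProduct.mk S A (⋀[S]^n P) a) :=
    Submodule.smul_le.2 fun s hs p _ ↦ by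
      rw [LinearMap.mem_ker, TensorProduct.mk_apply, ← TensorProduct.smul_tmul, Algebra.smul_def,
        RingHom.mem_ker.1 hs, zero_mul, TensorProduct.zero_tmul]
  exact hle h

lemma coe_zeroEquiv_symm (s : S) :
    ((exteriorPower.zeroEquiv S P).symm s : ExteriorAlgebra S P) = algebraMap S _ s := by
  rw [Algebra.algebraMap_eq_smul_one]
  simp [exteriorPower.zeroEquiv]

/-- The augmentation of the Koszul complex. -/
noncomputable def koszulAug (S A P : Type*) [CommRing S] [CommRing A] [Algebra S A]
    [AddCommGroup P] [Module S P] : ⋀[S]^0 P →ₗ[S] A :=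
  Algebra.linearMap S A ∘ₗ (exteriorPower.zeroEquiv S P).toLinearMap

lemma koszulAug_surjective (h : Function.Surjective (algebraMap S A)) :
    Function.Surjective (koszulAug S A P) :=
  h.comp (exteriorPower.zeroEquiv S P).surjective

lemma koszulD_koszulAug_exact {φ : P →ₗ[S] S}
    (hφ : LinearMap.range φ = RingHom.ker (algebraMap S A)) :
    Function.Exact (koszulD φ 0) (koszulAug S A P) := by
  have h (p : P) : koszulD φ 0 ⟨ι S p * 1, ι_mul_mem p (by simp [exteriorPower])⟩ =
      (exteriorPower.zeroEquiv S P).symm (φ p) := by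
    ext
    rw [coe_koszulD, coe_zeroEquiv_symm]
    simp only
    rw [contract_ι_mul, contract_one, mul_zero, sub_zero, Algebra.algebraMap_eq_smul_one]
  have h₁ (ω : ⋀[S]^1 P) : ∃ p, ω = ⟨ι S p * 1, ι_mul_mem p (by simp [exteriorPower])⟩ := by
    obtain ⟨ω, hω⟩ := ω
    have := hω
    rw [exteriorPower, pow_one] at this
    obtain ⟨p, rfl⟩ := this
    exact ⟨p, by simp⟩
  intro x
  obtain ⟨s, rfl⟩ := (exteriorPower.zeroEquiv S P).symm.surjective x
  have hs : koszulAug S A P ((exteriorPower.zeroEquiv S P).symm s) = algebraMap S A s := by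
    simp [koszulAug]
  rw [hs, ← RingHom.mem_ker, ← Submodule.restrictScalars_mem S, ← hφ]
  constructor
  · rintro ⟨p, rfl⟩
    exact ⟨_, h p⟩
  · rintro ⟨ω, hω⟩
    obtain ⟨p, rfl⟩ := h₁ ω
    rw [h] at hω
    exact ⟨p, (exteriorPower.zeroEquiv S P).symm.injective hω⟩

end KoszulAugmentation

section TensorSelf

theorem nonempty_tor_koszul {B A P : Type u} [CommRing B] (M : Submonoid B) [CommRing A]
    [Algebra B A] [Algebra (Localization M) A] [IsScalarTower B (Localization M) A]
    [AddCommGroup P] [Module (Localization M) P] [Module.Projective (Localization M) P]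
    (hA : Function.Surjective (algebraMap (Localization M) A)) (φ : P →ₗ[Localization M] Localization M)
    (hφ : LinearMap.range φ = RingHom.ker (algebraMap (Localization M) A))
    (hex : ∀ n, Function.Exact (koszulD φ (n + 1)) (koszulD φ n)) (n : ℕ) :
    Nonempty (((Tor (ModuleCat.{u} B) n).obj (ModuleCat.of B A)).obj (ModuleCat.of B A) ≃ₗ[B]
      A ⊗[Localization M] ⋀[Localization M]^n P) := by
  have hφ' : ∀ p, algebraMap (Localization M) A (φ p) = 0 := fun p ↦ by
    have : φ p ∈ LinearMap.range φ := ⟨p, rfl⟩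
    rwa [hφ] at this
  let (n : ℕ) : Module B (⋀[Localization M]^n P) := Module.compHom _ (algebraMap B (Localization M))
  have (n : ℕ) : IsScalarTower B (Localization M) (⋀[Localization M]^n P) :=
    .of_algebraMap_smul fun _ _ ↦ rfl
  let f (n : ℕ) : A ⊗[Localization M] (⋀[Localization M]^n P) ≃ₗ[B] A ⊗[B] ⋀[Localization M]^n P :=
    TensorProduct.equivOfCompatibleSMul B (Localization M) B A _
  obtain ⟨e⟩ := nonempty_tor_linearEquiv M A A
    (fun n ↦ ⋀[Localization M]^n P) (koszulD φ) (koszulAug (Localization M) A P) hex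
    (koszulD_koszulAug_exact hφ) (koszulAug_surjective hA)
    (fun n a p ↦ by
      have := congrArg (f n) (tmul_koszulD hφ' a p)
      rwa [map_zero] at this) n
  exact ⟨e ≪≫ₗ (f n).symm⟩

variable {k A : Type u} [Field k] [CommRing A] [Algebra k A]

lemma mem_span_range_includeRight (b : A ⊗[k] A) :
    b ∈ Submodule.span A (Set.range (Algebra.TensorProduct.includeRight : A →ₐ[k] A ⊗[k] A)) := by
  induction b with
  | zero => exact zero_mem _
  | add x y hx hy => exact add_mem hx hy
  | tmul a b =>
    have h : a ⊗ₜ[k] b = a • (1 : A) ⊗ₜ[k] b := by rw [TensorProduct.smul_tmul', smul_eq_mul, mul_one]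
    rw [h]
    exact Submodule.smul_mem _ _ (Submodule.subset_span ⟨b, rfl⟩)

lemma exists_tensor_exteriorPower_equiv [Algebra (A ⊗[k] A) A] [Algebra (DiagLoc k A) A]
    [IsScalarTower (A ⊗[k] A) (DiagLoc k A) A] [IsScalarTower A (DiagLoc k A) A]
    (h : ∀ b, algebraMap (A ⊗[k] A) A b = mulAug k A b) (n : ℕ) :
    Nonempty (A ⊗[DiagLoc k A] ⋀[DiagLoc k A]^n Ω[DiagLoc k A⁄A] ≃ₗ[A] ⋀[A]^n Ω[A⁄k]) := by
  have : IsScalarTower A (A ⊗[k] A) A := .of_algebraMap_eq fun a ↦ ((h _).trans (mul_one a)).symm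
  obtain ⟨D', hD⟩ := exists_derivation_tensorProduct (k := k) (A := A) (N := Ω[A⁄k])
    (mN := instModuleKaehlerDifferentialOfSMulCommClass k A)
    (tN := KaehlerDifferential.isScalarTower_of_tower k A) h (KaehlerDifferential.D k A)
  obtain ⟨g, hg, hker⟩ := exists_kaehlerDifferential_reduction (S := DiagLoc k A)
    (MonoidHom.mker (mulAug k A)) (Algebra.TensorProduct.includeRight : A →ₐ[k] A ⊗[k] A)
    (fun a ↦ (h _).trans (one_mul a))
    mem_span_range_includeRight D' hD
  have hA : Function.Surjective (algebraMap (DiagLoc k A) A) := fun a ↦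
    ⟨algebraMap A _ a, by rw [← IsScalarTower.algebraMap_apply]; rfl⟩
  exact ⟨exteriorPowerTensorEquiv hA hg hker n⟩

lemma exists_addEquiv_map_smul {B A T Z Y : Type*} [CommRing B] [CommRing A] [Algebra B A]
    [AddCommGroup T] [Module B T] [AddCommGroup Z] [Module B Z] [Module A Z] [IsScalarTower B A Z]
    [AddCommGroup Y] [Module A Y] (e : T ≃ₗ[B] Z) (f : Z ≃ₗ[A] Y) :
    ∃ e : T ≃+ Y, ∀ (b : B) x, e (b • x) = algebraMap B A b • e x :=
  ⟨e.toAddEquiv.trans f.toAddEquiv, fun b x ↦ by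
    change f (e (b • x)) = algebraMap B A b • f (e x)
    rw [map_smul, ← algebraMap_smul A b, map_smul]⟩

theorem exists_tor_equiv [CharZero k] [Algebra.Smooth k A] [Algebra (A ⊗[k] A) A]
    (h : ∀ b, algebraMap (A ⊗[k] A) A b = mulAug k A b) (n : ℕ) :
    ∃ e : ((Tor (ModuleCat.{u} (A ⊗[k] A)) n).obj (ModuleCat.of (A ⊗[k] A) A)).obj
        (ModuleCat.of (A ⊗[k] A) A) ≃+ ⋀[A]^n Ω[A⁄k],
      ∀ b x, e (b • x) = mulAug k A b • e x := by
  let : Algebra (DiagLoc k A) A := (augLoc (mulAug k A)).toRingHom.toAlgebra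
  have : IsScalarTower (A ⊗[k] A) (DiagLoc k A) A :=
    .of_algebraMap_eq fun b ↦ (h b).trans (augLoc_algebraMap (mulAug k A) b).symm
  have : IsScalarTower A (DiagLoc k A) A :=
    .of_algebraMap_eq fun a ↦ ((augLoc (mulAug k A)).commutes a).symm
  have := Algebra.FormallySmooth.projective_kaehlerDifferential (R := A) (A := DiagLoc k A)
  have hA : Function.Surjective (algebraMap (DiagLoc k A) A) := fun a ↦
    ⟨algebraMap A _ a, by rw [← IsScalarTower.algebraMap_apply]; rfl⟩
  obtain ⟨φ, hφ, hex⟩ := exists_koszul_resolution k A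
  obtain ⟨e⟩ := nonempty_tor_koszul (MonoidHom.mker (mulAug k A)) hA φ hφ hex n
  obtain ⟨f⟩ := exists_tensor_exteriorPower_equiv h n
  obtain ⟨g, hg⟩ := exists_addEquiv_map_smul e f
  exact ⟨g, fun b x ↦ by rw [hg, h]⟩

end TensorSelf

end KoszulKaehler

/-- (Hochschild–Kostant–Rosenberg, affine case.)  Let `k` be a field of characteristic
zero and `A` a smooth `k`-algebra.  Regard `A` as a module over `A ⊗[k] A` via the
multiplication map `A ⊗[k] A → A`.  Then for every `n` there is an isomorphism of
`A`-modules `Tor_n^{A ⊗[k] A}(A, A) ≅ ⋀ⁿ_A Ω_{A/k}`.  (Both sides are modules over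
`A ⊗[k] A` through the multiplication map, and the isomorphism is `(A ⊗[k] A)`-linear,
which is the same as `A`-linearity since the actions factor through `A`.) -/
theorem tor_tensorProduct_self_iso_exteriorPower_kaehlerDifferential
    {k : Type u} [Field k] [CharZero k] (A : Type u) [CommRing A] [Algebra k A]
    [Algebra.Smooth k A] :
    ∀ n : ℕ,
    letI : Module (A ⊗[k] A) A :=
      Module.compHom A (Algebra.TensorProduct.lmul' k (S := A)).toRingHom
    letI : Module (A ⊗[k] A) (⋀[A]^n (Ω[A⁄k])) :=
      Module.compHom _ (Algebra.TensorProduct.lmul' k (S := A)).toRingHom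
    Nonempty
      ((((Tor (ModuleCat.{u} (A ⊗[k] A)) n).obj (ModuleCat.of (A ⊗[k] A) A)).obj
          (ModuleCat.of (A ⊗[k] A) A)) ≃ₗ[A ⊗[k] A] (⋀[A]^n (Ω[A⁄k]))) := by
  intro n
  obtain ⟨e, he⟩ := @KoszulKaehler.exists_tor_equiv k A _ _ _ _ _
    (Algebra.TensorProduct.lmul' k (S := A)).toRingHom.toAlgebra (fun _ ↦ rfl) n
  exact ⟨@AddEquiv.toLinearEquiv _ _ _ _ _ _ _ (Module.compHom _ _) e he⟩
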